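/- Fix q ∈ ℝ with 0 < q < 1 and define [[m]] = (q^{−m/2} − q^{m/2})/(q^{−1/2} − q^{1/2}) for integers m. For z ∈ ℂ, z ≠ 0, write η = (z + z⁻¹)/2, η₋ = (q^{1/2} z + q^{−1/2} z⁻¹)/2, η₊ = (q^{−1/2} z + q^{1/2} z⁻¹)/2. Then for every natural number n and every z ≠ 0: η₋^{n+1} − η₊^{n+1} = (η₋ − η₊) · Σ_{k=0}^{n} g_n^{(k)} η^{n−k}, where g_n^{(k)} = 0 for odd k, and for even k, g_n^{(k)} = ((n+1)!/2^k) · Σ_{r=0}^{k/2} C(n−k+r, r) · (−1)^r · [[n−k+1+2r]] / ( (k/2 − r)! · (n − k/2 + 1 + r)! ), with C(·,·) the binomial coefficient. -/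

import Mathlib

open Finset

/-- The `q`-bracket `[[m]] = (q^{-m/2} - q^{m/2})/(q^{-1/2} - q^{1/2})`. -/
noncomputable def qBracket (q : ℝ) (m : ℤ) : ℝ :=
  (q ^ (-(m : ℝ) / 2) - q ^ ((m : ℝ) / 2)) / (q ^ (-(1 : ℝ) / 2) - q ^ ((1 : ℝ) / 2))

/-- The expansion coefficient `g_n^{\prime (k)}` for the Askey-Wilson sinusoidal
coordinate. -/
noncomputable def gAW (q : ℝ) (n k : ℕ) : ℝ :=
  if Odd k then 0
  else ((n + 1).factorial / 2 ^ k : ℝ) *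
    ∑ r ∈ Finset.range (k / 2 + 1),
      (Nat.choose (n - k + r) r : ℝ) * (-1 : ℝ) ^ r
        * qBracket q ((n : ℤ) - (k : ℤ) + 1 + 2 * (r : ℤ))
        / ((k / 2 - r).factorial * (n - k / 2 + 1 + r).factorial : ℝ)


/-- Explicit Chebyshev sum. -/
noncomputable def chebSum (N : ℕ) (x : ℂ) : ℂ :=
  ∑ i ∈ range (N / 2 + 1), (-1 : ℂ) ^ i * (Nat.choose (N - i) i : ℂ) * x ^ (N - 2 * i)

lemma chebSum_rec (N : ℕ) (x : ℂ) :
    chebSum (N + 2) x = x * chebSum (N + 1) x - chebSum N x := by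
  have h1 : chebSum (N + 1) x = ∑ i ∈ range (N / 2 + 1 + 1),
      (-1 : ℂ) ^ i * (Nat.choose (N + 1 - i) i : ℂ) * x ^ (N + 1 - 2 * i) := by
    unfold chebSum
    apply Finset.sum_subset
    · intro i hi
      simp only [mem_range] at *
      omega
    · intro i hi hi'
      simp only [mem_range] at *
      rw [Nat.choose_eq_zero_of_lt (by omega)]
      simp
  rw [h1]
  unfold chebSum
  rw [show (N + 2) / 2 + 1 = N / 2 + 1 + 1 by omega, Finset.sum_range_succ', Finset.sum_range_succ' _ (N / 2 + 1)]
  rw [mul_add, Finset.mul_sum, add_sub_right_comm, ← Finset.sum_sub_distrib]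
  congr 1
  · apply Finset.sum_congr rfl
    intro i hi
    simp only [mem_range] at hi
    rw [show N + 2 - (i + 1) = (N - i) + 1 by omega, Nat.choose_succ_succ',
      show N + 1 - (i + 1) = N - i by omega, show N + 2 - 2 * (i + 1) = N - 2 * i by omega]
    rcases Nat.lt_or_ge (2 * i) N with h | h
    · rw [show N - 2 * i = (N + 1 - 2 * (i + 1)) + 1 by omega]
      push_cast
      ring
    · rw [Nat.choose_eq_zero_of_lt (show N - i < i + 1 by omega)]
      push_cast
      ring
  · simp
    ring

lemma chebSum_eq (z : ℂ) (hz : z ≠ 0) (N : ℕ) :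
    (z - z⁻¹) * chebSum N (z + z⁻¹) = z ^ (N + 1) - z⁻¹ ^ (N + 1) := by
  have hzz : z * z⁻¹ = 1 := mul_inv_cancel₀ hz
  induction N using Nat.twoStepInduction with
  | zero => simp [chebSum]
  | one => simp [chebSum]; ring
  | more N h1 h2 =>
    rw [chebSum_rec, mul_sub, mul_left_comm, h1, h2]
    generalize z⁻¹ = w at *
    linear_combination (z ^ (N + 1) - w ^ (N + 1)) * hzz

lemma sum_even (G : ℕ → ℂ) (hG : ∀ k, Odd k → G k = 0) (n : ℕ) :
    ∑ k ∈ range (n + 1), G k = ∑ j ∈ range (n / 2 + 1), G (2 * j) := by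
  induction n with
  | zero => simp
  | succ n ih =>
    rw [Finset.sum_range_succ, ih]
    rcases Nat.even_or_odd (n + 1) with h | h
    · obtain ⟨c, hc⟩ := h
      rw [show (n + 1) / 2 + 1 = n / 2 + 1 + 1 by omega, Finset.sum_range_succ _ (n / 2 + 1)]
      congr 2
      omega
    · rw [hG _ h]
      obtain ⟨c, hc⟩ := h
      rw [show (n + 1) / 2 = n / 2 by omega, add_zero]

lemma sum_pair (n : ℕ) (h : ℕ → ℂ) (h0 : ∀ s, 2 * s = n + 1 → h s = 0) :
    ∑ s ∈ range (n + 2), h s = ∑ s ∈ range (n / 2 + 1), (h s + h (n + 1 - s)) := by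
  have key : ∀ g : ℕ → ℂ, ∑ s ∈ range (n / 2 + 1), g s
      = ∑ s ∈ range (n + 2), if 2 * s < n + 1 then g s else 0 := by
    intro g
    rw [← Finset.sum_filter]
    apply Finset.sum_congr _ (fun _ _ => rfl)
    ext s
    simp only [mem_range, mem_filter]
    omega
  rw [Finset.sum_add_distrib, key, key]
  rw [← Finset.sum_range_reflect (fun s => if 2 * s < n + 1 then h (n + 1 - s) else 0),
    ← Finset.sum_add_distrib]
  apply Finset.sum_congr rfl
  intro s hs
  simp only [mem_range] at hs
  rw [show n + 1 - (n + 2 - 1 - s) = s by omega]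
  rcases lt_trichotomy (2 * s) (n + 1) with h' | h' | h'
  · rw [if_pos h', if_neg (by omega), add_zero]
  · rw [h0 s h']; simp
  · rw [if_neg (by omega), if_pos (by omega), zero_add]

lemma qBracket_mul (q : ℝ) (hq0 : 0 < q) (hq1 : q < 1) (m : ℕ) :
    qBracket q (m : ℤ) * (Real.sqrt q - (Real.sqrt q)⁻¹)
      = Real.sqrt q ^ m - (Real.sqrt q)⁻¹ ^ m := by
  have e : ∀ k : ℕ, q ^ ((k : ℝ) / 2) = Real.sqrt q ^ k := by
    intro k
    rw [Real.sqrt_eq_rpow, ← Real.rpow_natCast, ← Real.rpow_mul hq0.le]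
    congr 1
    ring
  have e' : ∀ k : ℕ, q ^ (-(k : ℝ) / 2) = (Real.sqrt q)⁻¹ ^ k := by
    intro k
    rw [neg_div, Real.rpow_neg hq0.le, e, inv_pow]
  have ha : 0 < Real.sqrt q := Real.sqrt_pos.2 hq0
  have ha1 : Real.sqrt q < 1 := by
    rw [Real.sqrt_lt' one_pos]; simpa using hq1
  have hb : 1 < (Real.sqrt q)⁻¹ := (one_lt_inv₀ ha).2 ha1
  have e1 := e 1
  have e1' := e' 1
  simp only [Nat.cast_one, pow_one] at e1 e1'
  unfold qBracket
  rw [Int.cast_natCast, e, e', e1, e1']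
  have : (Real.sqrt q)⁻¹ - Real.sqrt q ≠ 0 := by linarith
  rw [div_mul_eq_mul_div, div_eq_iff this]
  ring

lemma gAW_even (q : ℝ) (n j : ℕ) (hj : 2 * j ≤ n) :
    gAW q n (2 * j) = ∑ s ∈ range (j + 1),
      (Nat.choose (n + 1) s : ℝ) * ((-1) ^ (j - s) * (Nat.choose (n - 2 * s - (j - s)) (j - s) : ℝ))
        * qBracket q ((n + 1 - 2 * s : ℕ) : ℤ) / 2 ^ (2 * j) := by
  unfold gAW
  rw [if_neg (by simp), show 2 * j / 2 = j by omega, ← Finset.sum_range_reflect, Finset.mul_sum]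
  apply Finset.sum_congr rfl
  intro s hs
  simp only [mem_range] at hs
  rw [show j + 1 - 1 - s = j - s by omega, show n - 2 * j + (j - s) = n - 2 * s - (j - s) by omega,
    show j - (j - s) = s by omega, show n - j + 1 + (j - s) = n + 1 - s by omega,
    show (n : ℤ) - (2 * j : ℕ) + 1 + 2 * ((j - s : ℕ) : ℤ) = ((n + 1 - 2 * s : ℕ) : ℤ) by omega,
    Nat.cast_choose ℝ (show s ≤ n + 1 by omega)]
  have h1 : (s.factorial : ℝ) ≠ 0 := by positivity
  have h2 : ((n + 1 - s).factorial : ℝ) ≠ 0 := by positivity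
  field_simp

lemma pow_expand (a z : ℂ) (n s : ℕ) (ha : a ≠ 0) (hz : z ≠ 0) (hs : 2 * s ≤ n + 1) :
    (a⁻¹ * z⁻¹) ^ s * (a * z) ^ (n + 1 - s) = a ^ (n + 1 - 2 * s) * z ^ (n + 1 - 2 * s) := by
  rw [show n + 1 - s = (n + 1 - 2 * s) + s by omega, pow_add,
    ← mul_pow a z (n + 1 - 2 * s), mul_left_comm, ← mul_pow (a⁻¹ * z⁻¹)]
  rw [show a⁻¹ * z⁻¹ * (a * z) = 1 by field_simp]
  simp

lemma lhs_expand (a z : ℂ) (n : ℕ) (ha : a ≠ 0) (hz : z ≠ 0) :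
    (a * z + a⁻¹ * z⁻¹) ^ (n + 1) - (a⁻¹ * z + a * z⁻¹) ^ (n + 1) =
      ∑ s ∈ range (n / 2 + 1), (Nat.choose (n + 1) s : ℂ) *
        ((a ^ (n + 1 - 2 * s) - a⁻¹ ^ (n + 1 - 2 * s)) *
          (z ^ (n + 1 - 2 * s) - z⁻¹ ^ (n + 1 - 2 * s))) := by
  rw [add_comm (a * z), add_comm (a⁻¹ * z), add_pow, add_pow, ← Finset.sum_sub_distrib, sum_pair]
  · apply Finset.sum_congr rfl
    intro s hs
    simp only [mem_range] at hs
    have hs' : 2 * s ≤ n + 1 := by omega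
    rw [show n + 1 - (n + 1 - s) = s by omega, Nat.choose_symm (show s ≤ n + 1 by omega)]
    have h1 := pow_expand a z n s ha hz hs'
    have h2 := pow_expand a⁻¹ z n s (inv_ne_zero ha) hz hs'
    have h3 := pow_expand a⁻¹ z⁻¹ n s (inv_ne_zero ha) (inv_ne_zero hz) hs'
    have h4 := pow_expand a z⁻¹ n s ha (inv_ne_zero hz) hs'
    rw [inv_inv] at h2 h4
    rw [inv_inv, inv_inv] at h3
    linear_combination ((n + 1).choose s : ℂ) * (h1 - h2 + h3 - h4)
  · intro s hs
    have h1 := pow_expand a z n s ha hz hs.le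
    have h2 := pow_expand a⁻¹ z n s (inv_ne_zero ha) hz hs.le
    rw [inv_inv] at h2
    rw [h1, h2, hs]
    simp

theorem stmt_11 (q : ℝ) (hq0 : 0 < q) (hq1 : q < 1) (n : ℕ) (z : ℂ) (hz : z ≠ 0) :
    (((Real.sqrt q : ℂ) * z + (Real.sqrt q : ℂ)⁻¹ * z⁻¹) / 2) ^ (n + 1)
        - (((Real.sqrt q : ℂ)⁻¹ * z + (Real.sqrt q : ℂ) * z⁻¹) / 2) ^ (n + 1) =
      (((Real.sqrt q : ℂ) * z + (Real.sqrt q : ℂ)⁻¹ * z⁻¹) / 2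
          - ((Real.sqrt q : ℂ)⁻¹ * z + (Real.sqrt q : ℂ) * z⁻¹) / 2) *
        ∑ k ∈ Finset.range (n + 1),
          (gAW q n k : ℂ) * (((z + z⁻¹) / 2) ^ (n - k)) := by
  have hB : ∀ m : ℕ, (Real.sqrt q : ℂ) ^ m - (Real.sqrt q : ℂ)⁻¹ ^ m
      = (qBracket q (m : ℤ) : ℂ) * ((Real.sqrt q : ℂ) - (Real.sqrt q : ℂ)⁻¹) := by
    intro m
    have := qBracket_mul q hq0 hq1 m
    exact_mod_cast this.symm
  have ha : (Real.sqrt q : ℂ) ≠ 0 := by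
    exact_mod_cast (Real.sqrt_pos.2 hq0).ne'
  rw [sum_even _ (fun k hk => by simp [gAW, hk])]
  rw [div_pow, div_pow, ← sub_div, lhs_expand _ z n ha hz]
  generalize (Real.sqrt q : ℂ) = a at *
  have L : ∀ s ∈ range (n / 2 + 1), (Nat.choose (n + 1) s : ℂ) *
        ((a ^ (n + 1 - 2 * s) - a⁻¹ ^ (n + 1 - 2 * s)) *
          (z ^ (n + 1 - 2 * s) - z⁻¹ ^ (n + 1 - 2 * s)))
      = ∑ j ∈ Ico s (n / 2 + 1), (a - a⁻¹) * (z - z⁻¹) * ((Nat.choose (n + 1) s : ℂ) *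
        ((-1) ^ (j - s) * (Nat.choose (n - 2 * s - (j - s)) (j - s) : ℂ))
        * (qBracket q ((n + 1 - 2 * s : ℕ) : ℤ) : ℂ)) * (z + z⁻¹) ^ (n - 2 * j) := by
    intro s hs
    simp only [mem_range] at hs
    rw [hB]
    have hc := chebSum_eq z hz (n - 2 * s)
    rw [show n - 2 * s + 1 = n + 1 - 2 * s by omega] at hc
    rw [← hc, Finset.sum_Ico_eq_sum_range]
    unfold chebSum
    rw [show (n - 2 * s) / 2 + 1 = n / 2 + 1 - s by omega]
    simp only [Finset.mul_sum]
    apply Finset.sum_congr rfl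
    intro i hi
    rw [show s + i - s = i by omega, show n - 2 * (s + i) = n - 2 * s - 2 * i by omega]
    ring
  rw [Finset.sum_congr rfl L, Finset.sum_comm' (t' := range (n / 2 + 1)) (s' := fun j => range (j + 1))
    (by intro x y; simp only [mem_range, mem_Ico]; omega), Finset.sum_div, Finset.mul_sum]
  apply Finset.sum_congr rfl
  intro j hj
  simp only [mem_range] at hj
  rw [gAW_even q n j (by omega)]
  push_cast
  rw [Finset.sum_div, Finset.sum_mul, Finset.mul_sum]
  apply Finset.sum_congr rfl
  intro s hs
  rw [div_pow]
  have h2 : (2 : ℂ) ^ (n + 1) = 2 * 2 ^ (2 * j) * 2 ^ (n - 2 * j) := by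
    rw [mul_assoc, ← pow_add, ← pow_succ']
    congr 1
    omega
  rw [h2]
  field_simp
  ring
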